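/- Let s ≥ 2, m ≥ s, and let 0 < a₀ ≤ a₁ ≤ … ≤ a_{s−1} be integers with a_{s−2} = a_{s−1}. Let A = {k·e_s : 0 ≤ k ≤ a₀} ∪ {e_i + k·e_s : 1 ≤ i ≤ s−1, 0 ≤ k ≤ a_i} ∪ {e_j : s+1 ≤ j ≤ m} ⊆ ℤ_{≥0}^m (the lattice points of the (m−s)-fold iterated pyramid over the Lawrence prism L(a₀,…,a_{s−1})). Then for every prime power q with a_{s−1} ≤ q − 2, the toric code C_A(𝔽_q) has length (q−1)^m, rank m + Σ_{i=0}^{s−1} a_i, and minimum distance (q−1)^m − (q−1)^{m−2}·((q−1) + a_{s−1}·(q−2)). -/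

import Mathlib

/-- The toric code: image of the evaluation map sending a coefficient vector
`c : A → 𝔽` to the function `(𝔽ˣ)^m → 𝔽`, `α ↦ ∑_{a ∈ A} c a · α^a`. -/
def toricCode (F : Type) [Field F] (m : ℕ) (A : Finset (Fin m → ℕ)) :
    Set ((Fin m → Fˣ) → F) :=
  {w | ∃ c : (Fin m → ℕ) → F, ∀ α : Fin m → Fˣ, w α = ∑ a ∈ A, c a * ∏ i, (α i : F) ^ a i}

open Classical in
/-- The dual toric code: functionals `y` with `∑_α y α · w α = 0` for all words `w`. -/
noncomputable def dualToricCode (F : Type) [Field F] [Fintype F] (m : ℕ)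
    (A : Finset (Fin m → ℕ)) : Set ((Fin m → Fˣ) → F) :=
  {y | ∀ w ∈ toricCode F m A, ∑ α : Fin m → Fˣ, y α * w α = 0}

/-- The weight of a word: the cardinality of its support. -/
noncomputable def wt {m : ℕ} {F : Type} [Field F] (y : (Fin m → Fˣ) → F) : ℕ :=
  (Function.support y).ncard

/-- The minimum distance of a code: least weight of a nonzero word. -/
noncomputable def dmin {m : ℕ} {F : Type} [Field F] (C : Set ((Fin m → Fˣ) → F)) : ℕ :=
  sInf {k | ∃ y ∈ C, y ≠ 0 ∧ wt y = k}

/-- The `t`-th standard basis vector of `ℤ^m` (`1`-based index `t+1`). -/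
def E (m t : ℕ) : Fin m → ℕ := fun j => if (j : ℕ) = t then 1 else 0

open Polynomial in
/-- The word of the toric code given by `∑ i, u i * g i (t)`, where `t` is the coordinate `p`,
`u p = 1` and `u i` is the `i`-th coordinate for `i ≠ p`. -/
noncomputable def prismWord (F : Type) [Field F] {m : ℕ} (p : Fin m) :
    (Fin m → F[X]) →ₗ[F] ((Fin m → Fˣ) → F) where
  toFun g α := ∑ i, ((if i = p then 1 else α i : Fˣ) : F) * (g i).eval (α p : F)
  map_add' g h := by
    ext α
    simp [mul_add, Finset.sum_add_distrib]
  map_smul' r g := by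
    ext α
    simp only [Pi.smul_apply, eval_smul, smul_eq_mul, RingHom.id_apply, Finset.mul_sum]
    exact Finset.sum_congr rfl fun i _ => by ring

/-- The exponent vector of the monomial `u i * t ^ k` with `u p = 1`. -/
def prismExponent {m : ℕ} (p : Fin m) (x : Fin m × ℕ) : Fin m → ℕ :=
  (if x.1 = p then 0 else Pi.single x.1 1) + x.2 • Pi.single p 1

section

variable {F : Type} [Field F] {m : ℕ}

theorem prismExponent_injective (p : Fin m) : Function.Injective (prismExponent p) := by
  have hp : ∀ x : Fin m × ℕ, prismExponent p x p = x.2 := by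
    intro x
    unfold prismExponent
    split_ifs with h
    · simp
    · simp [Ne.symm h]
  have hj : ∀ x : Fin m × ℕ, ∀ j, j ≠ p → prismExponent p x j = if j = x.1 then 1 else 0 := by
    intro x j hjp
    unfold prismExponent
    split_ifs with h h' h' <;> simp_all
  rintro ⟨i, k⟩ ⟨i', k'⟩ h
  have hk : k = k' := by simpa [hp] using congrFun h p
  refine Prod.ext ?_ hk
  by_cases hi : i = p
  · by_contra hne
    have hi' : i' ≠ p := fun h' => hne (hi.trans h'.symm)
    have := congrFun h i'
    rw [hj _ _ hi', hj _ _ hi'] at this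
    simp only at hne
    simp [Ne.symm hne] at this
  · have := congrFun h i
    rw [hj _ _ hi, hj _ _ hi] at this
    by_contra hne
    simp only at hne
    simp [hne] at this

theorem prod_pow_prismExponent (p i : Fin m) (k : ℕ) (α : Fin m → Fˣ) :
    ∏ j, (α j : F) ^ prismExponent p (i, k) j
      = ((if i = p then 1 else α i : Fˣ) : F) * (α p : F) ^ k := by
  have hs : ∀ i : Fin m, ∏ j, (α j : F) ^ (Pi.single i 1 : Fin m → ℕ) j = α i := by
    intro i
    rw [Finset.prod_eq_single i]
    · simp
    · intro j _ hj
      simp [hj]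
    · simp
  unfold prismExponent
  simp only [Pi.add_apply, pow_add, Finset.prod_mul_distrib, Pi.smul_apply, smul_eq_mul,
    mul_comm k, pow_mul, Finset.prod_pow, hs]
  split_ifs
  · simp
  · rw [hs]

open Polynomial in
theorem natDegree_le_of_mem_degreeLT_succ {f : F[X]} {n : ℕ} (hf : f ∈ degreeLT F (n + 1)) :
    f.natDegree ≤ n := by
  by_cases h0 : f = 0
  · simp [h0]
  · exact Nat.lt_succ_iff.mp ((natDegree_lt_iff_degree_lt h0).mpr (mem_degreeLT.mp hf))

open Polynomial in
theorem mem_toricCode_iff_prismWord (p : Fin m) (d : Fin m → ℕ) (A : Finset (Fin m → ℕ))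
    (hA : ∀ v, v ∈ A ↔ ∃ i k, k ≤ d i ∧ v = prismExponent p (i, k)) (w : (Fin m → Fˣ) → F) :
    w ∈ toricCode F m A ↔
      ∃ g : Fin m → F[X], (∀ i, g i ∈ degreeLT F (d i + 1)) ∧ prismWord F p g = w := by
  classical
  have hsum : ∀ (c : (Fin m → ℕ) → F) (α : Fin m → Fˣ),
      ∑ v ∈ A, c v * ∏ i, (α i : F) ^ v i
        = ∑ i, ((if i = p then 1 else α i : Fˣ) : F) *
            ∑ k ∈ Finset.range (d i + 1), c (prismExponent p (i, k)) * (α p : F) ^ k := by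
    intro c α
    have hA' : A = (Finset.univ.sigma fun i => Finset.range (d i + 1)).image
        fun x : (_ : Fin m) × ℕ => prismExponent p (x.1, x.2) := by
      ext v
      rw [hA]
      simp only [Finset.mem_image, Finset.mem_sigma, Finset.mem_univ, true_and, Finset.mem_range,
        Nat.lt_succ_iff, Sigma.exists]
      exact exists_congr fun i => exists_congr fun k => and_congr_right fun _ => eq_comm
    rw [hA', Finset.sum_image, Finset.sum_sigma]
    · refine Finset.sum_congr rfl fun i _ => ?_
      rw [Finset.mul_sum]
      refine Finset.sum_congr rfl fun k _ => ?_
      rw [prod_pow_prismExponent]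
      ring
    · rintro ⟨i, k⟩ _ ⟨i', k'⟩ _ h
      have := prismExponent_injective p h
      simp_all
  constructor
  · rintro ⟨c, hc⟩
    refine ⟨fun i => ∑ k ∈ Finset.range (d i + 1), C (c (prismExponent p (i, k))) * X ^ k,
      fun i => ?_, ?_⟩
    · refine Submodule.sum_mem _ fun k hk => ?_
      rw [mem_degreeLT]
      refine (degree_C_mul_X_pow_le _ _).trans_lt ?_
      exact_mod_cast Finset.mem_range.mp hk
    · ext α
      rw [hc, hsum]
      simp [prismWord, eval_finsetSum]
  · rintro ⟨g, hg, rfl⟩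
    refine ⟨Function.extend (prismExponent p) (fun x => (g x.1).coeff x.2) 0, fun α => ?_⟩
    rw [hsum]
    simp only [(prismExponent_injective p).extend_apply]
    change ∑ i, ((if i = p then 1 else α i : Fˣ) : F) * (g i).eval (α p : F) = _
    refine Finset.sum_congr rfl fun i _ => ?_
    rw [eval_eq_sum_range' (Nat.lt_succ_of_le (natDegree_le_of_mem_degreeLT_succ (hg i)))]

theorem card_le_pow_of_eqOn_compl {ι X : Type*} [Fintype ι] [DecidableEq ι] [Fintype X]
    (S : Finset (ι → X)) (K : Finset ι)
    (h : ∀ α ∈ S, ∀ β ∈ S, (∀ i ∉ K, α i = β i) → α = β) :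
    S.card ≤ Fintype.card X ^ (Fintype.card ι - K.card) := by
  classical
  have := Finset.card_le_card_of_injOn (s := S) (t := Finset.univ)
    (fun α (i : ↥(Kᶜ)) => α i) (by simp) (by
      intro α hα β hβ hab
      refine h α hα β hβ fun i hi => ?_
      exact congrFun hab ⟨i, by simpa using hi⟩)
  simpa [Finset.card_compl] using this

variable [Fintype F] [DecidableEq F]

open Polynomial in
theorem card_prismWord_eq_zero_le (hm : 2 ≤ m) (p : Fin m) (g : Fin m → F[X]) (b : ℕ)
    (hg : ∀ i, (g i).natDegree ≤ b) (hne : g ≠ 0) (hb : b ≤ Fintype.card Fˣ) :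
    (Finset.univ.filter fun α : Fin m → Fˣ => prismWord F p g α = 0).card
      ≤ Fintype.card Fˣ ^ (m - 2) *
          (Fintype.card Fˣ + b * (Fintype.card Fˣ - 1)) := by
  set N := Fintype.card Fˣ with hN
  set R : Finset Fˣ := Finset.univ.filter fun t => ∀ i, (g i).eval (t : F) = 0 with hR
  have hRb : R.card ≤ b := by
    obtain ⟨i, hi⟩ := Function.ne_iff.mp hne
    refine le_trans ?_ (hg i)
    refine le_trans ?_ (card_roots' (g i))
    refine le_trans ?_ (Multiset.toFinset_card_le _)
    refine Finset.card_le_card_of_injOn (fun t : Fˣ => (t : F)) ?_ (Units.val_injective.injOn)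
    intro t ht
    have := (Finset.mem_filter.mp ht).2 i
    simpa [hi] using ⟨hi, this⟩
  have hfib : ∀ t : Fˣ, ((Finset.univ.filter fun α : Fin m → Fˣ => prismWord F p g α = 0).filter
      fun α => α p = t).card ≤ if t ∈ R then N ^ (m - 1) else N ^ (m - 2) := by
    intro t
    split_ifs with ht
    · have := card_le_pow_of_eqOn_compl
        ((Finset.univ.filter fun α : Fin m → Fˣ => prismWord F p g α = 0).filter
          fun α => α p = t) {p} (by
        intro α hα β hβ h
        simp only [Finset.mem_filter] at hα hβ
        funext i
        by_cases hi : i = p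
        · rw [hi, hα.2, hβ.2]
        · exact h i (by simpa using hi))
      simpa using this
    · by_cases hex : ∃ j, j ≠ p ∧ (g j).eval (t : F) ≠ 0
      · obtain ⟨j, hjp, hj⟩ := hex
        have := card_le_pow_of_eqOn_compl
          ((Finset.univ.filter fun α : Fin m → Fˣ => prismWord F p g α = 0).filter
            fun α => α p = t) {p, j} (by
          intro α hα β hβ h
          simp only [Finset.mem_filter, Finset.mem_univ, true_and] at hα hβ
          obtain ⟨hα0, hαt⟩ := hα
          obtain ⟨hβ0, hβt⟩ := hβ
          simp only [prismWord, LinearMap.coe_mk, AddHom.coe_mk] at hα0 hβ0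
          rw [hαt, ← Finset.add_sum_erase _ _ (Finset.mem_univ j)] at hα0
          rw [hβt, ← Finset.add_sum_erase _ _ (Finset.mem_univ j)] at hβ0
          have hrest : ∀ i, i ≠ j → (if i = p then 1 else α i) = if i = p then 1 else β i := by
            intro i hij
            split_ifs with hip
            · rfl
            · exact h i (by simp [hip, hij])
          rw [Finset.sum_congr rfl fun i hi => by
            rw [hrest i (Finset.ne_of_mem_erase hi)]] at hα0
          have hjj := add_right_cancel (hα0.trans hβ0.symm)
          rw [if_neg hjp, if_neg hjp] at hjj
          have hjj' : α j = β j := Units.ext (mul_right_cancel₀ hj hjj)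
          funext i
          by_cases hip : i = p
          · rw [hip, hαt, hβt]
          · by_cases hij : i = j
            · rw [hij, hjj']
            · exact h i (by simp [hip, hij]))
        simpa [Finset.card_pair (Ne.symm hjp)] using this
      · push Not at hex
        have hp : (g p).eval (t : F) ≠ 0 := by
          intro h0
          refine ht (Finset.mem_filter.mpr ⟨Finset.mem_univ _, fun i => ?_⟩)
          by_cases hi : i = p
          · rw [hi, h0]
          · exact hex i hi
        rw [Finset.card_eq_zero.mpr]
        · exact Nat.zero_le _
        · refine Finset.filter_eq_empty_iff.mpr ?_
          intro α hα hαt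
          have hα0 : ∑ i, ((if i = p then 1 else α i : Fˣ) : F) * (g i).eval (α p : F) = 0 :=
            (Finset.mem_filter.mp hα).2
          rw [hαt, Finset.sum_eq_single p (fun i _ hi => by rw [hex i hi, mul_zero])
            (by simp)] at hα0
          simp [hp] at hα0
  rw [Finset.card_eq_sum_card_fiberwise (f := fun α : Fin m → Fˣ => α p) (t := Finset.univ)
    (fun _ _ => by simp)]
  refine (Finset.sum_le_sum fun t _ => hfib t).trans ?_
  rw [Finset.sum_ite]
  simp only [Finset.sum_const, smul_eq_mul, Finset.filter_mem_eq_inter, Finset.univ_inter]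
  have hc : (Finset.univ.filter fun t => t ∉ R).card = N - R.card := by
    rw [hN, ← Finset.card_compl]
    congr 1
    ext
    simp
  rw [hc]
  obtain ⟨n, rfl⟩ := Nat.exists_eq_add_of_le' hm
  have hN1 : 1 ≤ N := Fintype.card_pos
  have hRN : R.card ≤ N := hRb.trans hb
  obtain ⟨N', hN'⟩ := Nat.exists_eq_add_of_le' hN1
  calc R.card * N ^ (n + 2 - 1) + (N - R.card) * N ^ (n + 2 - 2)
      = N ^ n * (R.card * N + (N - R.card)) := by
        simp only [Nat.add_sub_cancel, show n + 2 - 1 = n + 1 by omega]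
        ring
    _ = N ^ n * (N + R.card * (N - 1)) := by
        congr 1
        have : R.card * N = R.card * (N - 1) + R.card := by
          rw [hN', Nat.add_sub_cancel]
          ring
        omega
    _ ≤ N ^ (n + 2 - 2) * (N + b * (N - 1)) := by
        simp only [Nat.add_sub_cancel]
        gcongr

theorem wt_add_card_eq_zero (w : (Fin m → Fˣ) → F) :
    wt w + (Finset.univ.filter fun α => w α = 0).card = Fintype.card Fˣ ^ m := by
  have : wt w = (Finset.univ.filter fun α => w α ≠ 0).card := by
    unfold wt
    rw [← Set.ncard_coe_finset]
    congr 1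
    ext
    simp
  rw [this, add_comm, Finset.card_filter_add_card_filter_not]
  simp

open Polynomial in
theorem exists_wt_prismWord_le (p i j : Fin m) (hip : i ≠ p) (hij : i ≠ j) (b : ℕ)
    (hb : b ≤ Fintype.card Fˣ) :
    ∃ f : F[X], f.Monic ∧ f.natDegree = b ∧
      wt (prismWord F p (Pi.single i f - Pi.single j f)) ≤
        (Fintype.card Fˣ - b) * (Fintype.card Fˣ - 1) * Fintype.card Fˣ ^ (m - 2) := by
  obtain ⟨S, -, hS⟩ := Finset.exists_subset_card_eq (s := (Finset.univ : Finset Fˣ)) hb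
  refine ⟨∏ t ∈ S, (X - C (t : F)), monic_prod_X_sub_C _ _, by simp [hS], ?_⟩
  set u : Fin m → (Fin m → Fˣ) → Fˣ := fun k α => if k = p then 1 else α k with hu
  set f : F[X] := ∏ t ∈ S, (X - C (t : F)) with hf
  have hw : ∀ α, prismWord F p (Pi.single i f - Pi.single j f) α
      = ((α i : F) - u j α) * f.eval (α p : F) := by
    have hs : ∀ k α, prismWord F p (Pi.single k f) α = u k α * f.eval (α p : F) := by
      intro k α
      change ∑ l, ((if l = p then 1 else α l : Fˣ) : F) *
        ((Pi.single k f : Fin m → F[X]) l).eval (α p : F) = _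
      rw [Finset.sum_eq_single k]
      · simp [hu]
      · intro l _ hl
        simp [Pi.single_eq_of_ne hl]
      · simp
    intro α
    rw [map_sub, Pi.sub_apply, hs, hs, ← sub_mul]
    simp [hu, hip]
  set T : Finset (Fˣ × Fˣ × (↥(({p, i} : Finset (Fin m))ᶜ) → Fˣ)) :=
    Sᶜ ×ˢ ({1}ᶜ : Finset Fˣ) ×ˢ Finset.univ with hT
  have hTcard : T.card
      = (Fintype.card Fˣ - b) * (Fintype.card Fˣ - 1) * Fintype.card Fˣ ^ (m - 2) := by
    rw [hT, Finset.card_product, Finset.card_product, Finset.card_compl, Finset.card_compl, hS,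
      Finset.card_univ, Fintype.card_fun, Fintype.card_coe, Finset.card_compl,
      Finset.card_pair (Ne.symm hip), Fintype.card_fin, Finset.card_singleton, mul_assoc]
  rw [← hTcard, ← Set.ncard_coe_finset]
  unfold wt
  refine Set.ncard_le_ncard_of_injOn
    (fun α => (α p, α i / u j α, fun k : ↥(({p, i} : Finset (Fin m))ᶜ) => α k)) ?_ ?_
    (Finset.finite_toSet T)
  · intro α hα
    rw [Function.mem_support, hw] at hα
    have h1 := left_ne_zero_of_mul hα
    have h2 := right_ne_zero_of_mul hα
    simp only [hT, Finset.coe_product, Set.mem_prod, Finset.mem_coe, Finset.mem_compl,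
      Finset.mem_singleton, Finset.mem_univ, and_true]
    refine ⟨fun h => h2 ?_, fun h => h1 ?_⟩
    · rw [hf, eval_prod]
      exact Finset.prod_eq_zero h (by simp)
    · rw [div_eq_one.mp h, sub_self]
  · intro α _ β _ h
    simp only [Prod.mk.injEq] at h
    obtain ⟨h1, h2, h3⟩ := h
    have h4 : ∀ k, k ≠ i → α k = β k := by
      intro k hk
      by_cases hkp : k = p
      · rw [hkp, h1]
      · exact congrFun h3 ⟨k, by simp [hk, hkp]⟩
    have h5 : u j α = u j β := by
      simp only [hu]
      rw [h4 j (Ne.symm hij)]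
    rw [h5] at h2
    funext k
    by_cases hk : k = i
    · rw [hk]
      exact div_left_injective h2
    · exact h4 k hk

theorem weight_identity (N b m : ℕ) (hm : 2 ≤ m) (hN : 1 ≤ N) (hb : b ≤ N) :
    N ^ m - N ^ (m - 2) * (N + b * (N - 1)) = (N - b) * (N - 1) * N ^ (m - 2) := by
  obtain ⟨n, rfl⟩ := Nat.exists_eq_add_of_le' hm
  obtain ⟨M, rfl⟩ := Nat.exists_eq_add_of_le' hN
  obtain ⟨c, hc⟩ := Nat.exists_eq_add_of_le hb
  rw [Nat.add_sub_cancel, Nat.add_sub_cancel, show M + 1 - b = c by omega]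
  refine Nat.sub_eq_of_eq_add ?_
  rw [pow_add]
  have : (M + 1) ^ 2 = c * M + (M + 1 + b * M) := by
    calc (M + 1) ^ 2 = (M + 1) * M + (M + 1) := by ring
      _ = (b + c) * M + (M + 1) := by rw [hc]
      _ = _ := by ring
  rw [this]
  ring

open Polynomial in
theorem le_wt_prismWord (hm : 2 ≤ m) (p : Fin m) (g : Fin m → F[X]) (b : ℕ)
    (hg : ∀ i, (g i).natDegree ≤ b) (hne : g ≠ 0) (hb : b ≤ Fintype.card Fˣ) :
    (Fintype.card Fˣ - b) * (Fintype.card Fˣ - 1) * Fintype.card Fˣ ^ (m - 2)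
      ≤ wt (prismWord F p g) := by
  rw [← weight_identity _ _ _ hm Fintype.card_pos hb, ← wt_add_card_eq_zero (prismWord F p g)]
  have := card_prismWord_eq_zero_le hm p g b hg hne hb
  omega

open Polynomial in
theorem prismWord_ne_zero (hm : 2 ≤ m) (p : Fin m) (g : Fin m → F[X]) (b : ℕ)
    (hg : ∀ i, (g i).natDegree ≤ b) (hne : g ≠ 0) (hb : b < Fintype.card Fˣ)
    (hF : 2 ≤ Fintype.card Fˣ) : prismWord F p g ≠ 0 := by
  intro h0
  have := le_wt_prismWord hm p g b hg hne hb.le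
  rw [h0] at this
  have hpos : 0 < (Fintype.card Fˣ - b) * (Fintype.card Fˣ - 1) * Fintype.card Fˣ ^ (m - 2) :=
    Nat.mul_pos (Nat.mul_pos (by omega) (by omega)) (by positivity)
  simp [wt] at this
  omega

open Polynomial in
theorem finrank_span_toricCode (hm : 2 ≤ m) (p : Fin m) (d : Fin m → ℕ)
    (A : Finset (Fin m → ℕ))
    (hA : ∀ v, v ∈ A ↔ ∃ i k, k ≤ d i ∧ v = prismExponent p (i, k)) (b : ℕ)
    (hd : ∀ i, d i ≤ b) (hb : b < Fintype.card Fˣ) (hF : 2 ≤ Fintype.card Fˣ) :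
    Module.finrank F ↥(Submodule.span F (toricCode F m A)) = m + ∑ i, d i := by
  let L : ((i : Fin m) → ↥(degreeLT F (d i + 1))) →ₗ[F] ((Fin m → Fˣ) → F) :=
    prismWord F p ∘ₗ LinearMap.pi fun i => (degreeLT F (d i + 1)).subtype ∘ₗ LinearMap.proj i
  have hL : toricCode F m A = (LinearMap.range L : Set ((Fin m → Fˣ) → F)) := by
    ext w
    rw [mem_toricCode_iff_prismWord p d A hA]
    constructor
    · rintro ⟨g, hg, rfl⟩
      exact ⟨fun i => ⟨g i, hg i⟩, rfl⟩
    · rintro ⟨g, rfl⟩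
      exact ⟨fun i => g i, fun i => (g i).2, rfl⟩
  have hinj : Function.Injective L := by
    refine (injective_iff_map_eq_zero L).mpr fun g hg => ?_
    by_contra hne
    refine prismWord_ne_zero hm p (fun i => (g i : F[X])) b (fun i => ?_) (fun h => hne ?_) hb hF hg
    · exact (natDegree_le_of_mem_degreeLT_succ (g i).2).trans (hd i)
    · funext i
      exact Subtype.ext (congrFun h i)
  rw [hL, Submodule.span_eq, LinearMap.finrank_range_of_inj hinj]
  have e : ∀ i, Module.finrank F ↥(degreeLT F (d i + 1)) = d i + 1 := fun i => by
    rw [(degreeLTEquiv F (d i + 1)).finrank_eq, Module.finrank_fin_fun]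
  have : ∀ i, Module.Finite F ↥(degreeLT F (d i + 1)) := fun i =>
    Module.Finite.equiv (degreeLTEquiv F (d i + 1)).symm
  rw [Module.finrank_pi_fintype]
  simp [e, Finset.sum_add_distrib, add_comm]

open Polynomial in
theorem dmin_toricCode (hm : 2 ≤ m) (p i j : Fin m) (hip : i ≠ p) (hij : i ≠ j) (d : Fin m → ℕ)
    (A : Finset (Fin m → ℕ))
    (hA : ∀ v, v ∈ A ↔ ∃ i k, k ≤ d i ∧ v = prismExponent p (i, k)) (b : ℕ)
    (hd : ∀ i, d i ≤ b) (hi : d i = b) (hj : d j = b) (hb : b < Fintype.card Fˣ)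
    (hF : 2 ≤ Fintype.card Fˣ) :
    dmin (toricCode F m A)
      = (Fintype.card Fˣ - b) * (Fintype.card Fˣ - 1) * Fintype.card Fˣ ^ (m - 2) := by
  have hlow : ∀ y ∈ toricCode F m A, y ≠ 0 →
      (Fintype.card Fˣ - b) * (Fintype.card Fˣ - 1) * Fintype.card Fˣ ^ (m - 2) ≤ wt y := by
    intro y hy hy0
    obtain ⟨g, hg, rfl⟩ := (mem_toricCode_iff_prismWord p d A hA y).mp hy
    exact le_wt_prismWord hm p g b
      (fun l => (natDegree_le_of_mem_degreeLT_succ (hg l)).trans (hd l))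
      (fun h => hy0 (by rw [h, map_zero])) hb.le
  obtain ⟨f, hf, hfb, hwt⟩ := exists_wt_prismWord_le (F := F) p i j hip hij b hb.le
  have hdeg : ∀ l, (Pi.single i f - Pi.single j f : Fin m → F[X]) l ∈ degreeLT F (d l + 1) := by
    have hs : ∀ k, d k = b → ∀ l, (Pi.single k f : Fin m → F[X]) l ∈ degreeLT F (d l + 1) := by
      intro k hk l
      by_cases hl : l = k
      · subst hl
        rw [Pi.single_eq_same, mem_degreeLT, degree_eq_natDegree hf.ne_zero, hfb, hk]
        exact_mod_cast Nat.lt_succ_self b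
      · rw [Pi.single_eq_of_ne hl]
        exact Submodule.zero_mem _
    intro l
    exact Submodule.sub_mem _ (hs i hi l) (hs j hj l)
  have hmem := (mem_toricCode_iff_prismWord p d A hA _).mpr ⟨_, hdeg, rfl⟩
  have hne : prismWord F p (Pi.single i f - Pi.single j f) ≠ 0 := by
    refine prismWord_ne_zero hm p _ b (fun l => ?_) (fun h => ?_) hb hF
    · exact (natDegree_le_of_mem_degreeLT_succ (hdeg l)).trans (hd l)
    · have := congrFun h i
      simp [Pi.single_eq_of_ne hij] at this
      exact hf.ne_zero this
  have hword : wt (prismWord F p (Pi.single i f - Pi.single j f)) ∈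
      {k | ∃ y ∈ toricCode F m A, y ≠ 0 ∧ wt y = k} := ⟨_, hmem, hne, rfl⟩
  refine le_antisymm ((Nat.sInf_le hword).trans hwt) (le_csInf ⟨_, hword⟩ ?_)
  rintro k ⟨y, hy, hy0, rfl⟩
  exact hlow y hy hy0

end

theorem E_eq_single {m t : ℕ} (ht : t < m) : E m t = Pi.single ⟨t, ht⟩ 1 := by
  funext j
  simp [E, Pi.single_apply, Fin.ext_iff]

theorem sum_lawrence_heights (s m : ℕ) (hs : 1 ≤ s) (hm : s ≤ m) (a : ℕ → ℕ) :
    ∑ i : Fin m, (if (i : ℕ) + 1 < s then a (i + 1) else if (i : ℕ) + 1 = s then a 0 else 0)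
      = ∑ i ∈ Finset.range s, a i := by
  obtain ⟨n, rfl⟩ := Nat.exists_eq_add_of_le' hs
  obtain ⟨r, rfl⟩ := Nat.exists_eq_add_of_le hm
  rw [Fin.sum_univ_eq_sum_range
    (fun i => if i + 1 < n + 1 then a (i + 1) else if i + 1 = n + 1 then a 0 else 0),
    Finset.sum_range_add, Finset.sum_range_succ, Finset.sum_range_succ']
  rw [Finset.sum_congr rfl fun i hi => if_pos (by simpa using hi),
    Finset.sum_eq_zero (s := Finset.range r) fun i _ => by
      rw [if_neg (by omega), if_neg (by omega)]]
  simp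

/-- For `A` the lattice points of the `(m−s)`-fold iterated pyramid over the
Lawrence prism `L(a₀,…,a_{s−1})` with `a_{s−2} = a_{s−1}` and `a_{s−1} ≤ q − 2`, the toric
code has length `(q−1)^m`, rank `m + ∑ aᵢ`, and minimum distance
`(q−1)^m − (q−1)^{m−2}·((q−1) + a_{s−1}(q−2))`. -/
theorem stmt14 (s m : ℕ) (hs : 2 ≤ s) (hm : s ≤ m) (a : ℕ → ℕ)
    (ha0 : 0 < a 0) (hmono : ∀ i j, i ≤ j → j < s → a i ≤ a j)
    (heq : a (s - 2) = a (s - 1))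
    (A : Finset (Fin m → ℕ))
    (hA : ∀ v : Fin m → ℕ, v ∈ A ↔
        ((∃ k, k ≤ a 0 ∧ v = k • E m (s - 1)) ∨
         (∃ i, 1 ≤ i ∧ i ≤ s - 1 ∧ ∃ k, k ≤ a i ∧ v = E m (i - 1) + k • E m (s - 1)) ∨
         (∃ j, s + 1 ≤ j ∧ j ≤ m ∧ v = E m (j - 1))))
    (F : Type) [Field F] [Fintype F] (hq : a (s - 1) ≤ Fintype.card F - 2) :
    Nat.card (Fin m → Fˣ) = (Fintype.card F - 1) ^ m ∧
    Module.finrank F ↥(Submodule.span F (toricCode F m A))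
      = m + ∑ i ∈ Finset.range s, a i ∧
    dmin (toricCode F m A)
      = (Fintype.card F - 1) ^ m - (Fintype.card F - 1) ^ (m - 2) *
          ((Fintype.card F - 1) + a (s - 1) * (Fintype.card F - 2)) := by
  classical
  have hm2 : 2 ≤ m := hs.trans hm
  have hN : Fintype.card Fˣ = Fintype.card F - 1 := Fintype.card_units F
  have hpos : 0 < a (s - 1) := ha0.trans_le (hmono 0 (s - 1) (Nat.zero_le _) (by omega))
  have hF : 2 ≤ Fintype.card Fˣ := by omega
  have hb : a (s - 1) < Fintype.card Fˣ := by omega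
  set d : Fin m → ℕ := fun i =>
    if (i : ℕ) + 1 < s then a (i + 1) else if (i : ℕ) + 1 = s then a 0 else 0 with hd
  let p : Fin m := ⟨s - 1, by omega⟩
  have hE : E m (s - 1) = Pi.single p 1 := E_eq_single (by omega)
  have hA' : ∀ v, v ∈ A ↔ ∃ i k, k ≤ d i ∧ v = prismExponent p (i, k) := by
    intro v
    rw [hA, hE]
    constructor
    · rintro (⟨k, hk, rfl⟩ | ⟨i, hi1, hi2, k, hk, rfl⟩ | ⟨j, hj1, hj2, rfl⟩)
      · refine ⟨p, k, ?_, by simp [prismExponent]⟩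
        simp only [hd, p]
        rwa [if_neg (by omega), if_pos (by omega)]
      · have hip : (⟨i - 1, by omega⟩ : Fin m) ≠ p := by
          simp only [p, ne_eq, Fin.mk.injEq]
          omega
        refine ⟨⟨i - 1, by omega⟩, k, ?_, ?_⟩
        · simp only [hd]
          rwa [if_pos (by omega), Nat.sub_add_cancel hi1]
        · rw [E_eq_single (by omega), prismExponent, if_neg hip]
      · have hjp : (⟨j - 1, by omega⟩ : Fin m) ≠ p := by
          simp only [p, ne_eq, Fin.mk.injEq]
          omega
        refine ⟨⟨j - 1, by omega⟩, 0, Nat.zero_le _, ?_⟩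
        rw [E_eq_single (by omega), prismExponent, if_neg hjp, zero_smul, add_zero]
    · rintro ⟨i, k, hk, rfl⟩
      by_cases hip : i = p
      · refine Or.inl ⟨k, ?_, by simp [prismExponent, hip]⟩
        simp only [hd, hip, p] at hk
        rwa [if_neg (by omega), if_pos (by omega)] at hk
      · have hip' : (i : ℕ) ≠ s - 1 := fun h => hip (Fin.ext h)
        have hEi : E m (i + 1 - 1) = Pi.single i 1 := E_eq_single i.isLt
        rw [prismExponent, if_neg hip]
        by_cases his : (i : ℕ) + 1 < s
        · refine Or.inr (Or.inl ⟨i + 1, by omega, by omega, k, ?_, by rw [hEi]⟩)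
          simpa only [hd, if_pos his] using hk
        · refine Or.inr (Or.inr ⟨i + 1, by omega, by omega, ?_⟩)
          simp only [hd] at hk
          rw [if_neg his, if_neg (by omega)] at hk
          rw [hEi, Nat.le_zero.mp hk, zero_smul, add_zero]
  have hdb : ∀ i, d i ≤ a (s - 1) := by
    intro i
    simp only [hd]
    split_ifs with h1 h2
    · exact hmono _ _ (by omega) (by omega)
    · exact hmono _ _ (by omega) (by omega)
    · exact Nat.zero_le _
  refine ⟨by simp [Nat.card_eq_fintype_card, hN], ?_, ?_⟩
  · rw [finrank_span_toricCode hm2 p d A hA' _ hdb hb hF, hd,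
      sum_lawrence_heights s m (by omega) hm]
  · let i : Fin m := ⟨s - 2, by omega⟩
    have hi : d i = a (s - 1) := by
      simp only [hd, i]
      rw [if_pos (by omega)]
      congr 1
      omega
    have hip : i ≠ p := by
      simp only [i, p, ne_eq, Fin.mk.injEq]
      omega
    obtain ⟨j, hij, hj⟩ : ∃ j, i ≠ j ∧ d j = a (s - 1) := by
      by_cases h2 : s = 2
      · refine ⟨p, hip, ?_⟩
        simp only [hd, p]
        rw [if_neg (by omega), if_pos (by omega), ← heq, h2]
      · refine ⟨⟨s - 3, by omega⟩, ?_, ?_⟩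
        · simp only [i, ne_eq, Fin.mk.injEq]
          omega
        · simp only [hd]
          rw [if_pos (by omega), ← heq]
          congr 1
          omega
    rw [dmin_toricCode hm2 p i j hip hij d A hA' _ hdb hi hj hb hF,
      ← weight_identity _ _ _ hm2 (by omega) hb.le, hN,
      show Fintype.card F - 1 - 1 = Fintype.card F - 2 by omega]
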